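/- Let (ΛV, d) be a Sullivan algebra over a field of characteristic zero, and let d₀ : V → V be the linear part of d. Suppose V decomposes as V = U ⊕ d₀U ⊕ W with d₀ restricted to U an isomorphism onto d₀U. Then the inclusion W ⊕ U ⊕ dU → ΛV induces an isomorphism of graded algebras Λ(W ⊕ U ⊕ dU) ≅ ΛV. -/

import Mathlib

open scoped TensorProduct

/-- The free graded-commutative algebra on even generators `x_i` (`i : ι`) and
odd generators `y_j` (`j : κ`), modelled as `K[x_i] ⊗ Λ(y_j)`. -/
abbrev FreeGC (K : Type) [Field K] (ι κ : Type) : Type :=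
  MvPolynomial ι K ⊗[K] ExteriorAlgebra K (κ →₀ K)

/-- The even generator `x_i`. -/
noncomputable def genEv (K : Type) [Field K] (ι κ : Type) (i : ι) : FreeGC K ι κ :=
  MvPolynomial.X i ⊗ₜ[K] 1

/-- The odd generator `y_j`. -/
noncomputable def genOd (K : Type) [Field K] (ι κ : Type) (j : κ) : FreeGC K ι κ :=
  1 ⊗ₜ[K] ExteriorAlgebra.ι K (Finsupp.single j 1)

section GradedGenerators

variable {K A : Type*} [Field K] [Ring A] [Algebra K A]

/-- If every monomial in a generating set lies in `S`, then `S` spans. -/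
theorem span_eq_top_of_closure_subset {s S : Set A} (hs : Algebra.adjoin K s = ⊤)
    (h : ∀ m ∈ Submonoid.closure s, m ∈ S) : Submodule.span K S = ⊤ := by
  refine top_unique ?_
  rw [← Algebra.top_toSubmodule, ← hs, Algebra.adjoin_eq_span]
  exact Submodule.span_mono h

theorem mem_graded_of_mem_span (𝒜 : ℕ → Submodule K A) [GradedAlgebra 𝒜] (f : A →ₗ[K] A)
    {v : A} (hv : v ∈ Submodule.span K {x | ∃ k, x ∈ 𝒜 k ∧ f x ∈ 𝒜 k}) {k : ℕ}
    (hvk : v ∈ 𝒜 k) : f v ∈ 𝒜 k := by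
  have key : GradedAlgebra.proj 𝒜 k (f v) = f (GradedAlgebra.proj 𝒜 k v) := by
    clear hvk
    induction hv using Submodule.span_induction with
    | mem x hx =>
      obtain ⟨j, hx, hfx⟩ := hx
      rcases eq_or_ne j k with rfl | hjk
      · simp [GradedAlgebra.proj_apply, DirectSum.decompose_of_mem_same, hx, hfx]
      · simp [GradedAlgebra.proj_apply, DirectSum.decompose_of_mem_ne _ hx hjk,
          DirectSum.decompose_of_mem_ne _ hfx hjk]
    | zero => simp
    | add x y _ _ hx hy => simp only [map_add, hx, hy]
    | smul c x _ hx => simp only [map_smul, hx]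
  rw [GradedAlgebra.proj_apply, GradedAlgebra.proj_apply,
    DirectSum.decompose_of_mem_same _ hvk] at key
  rw [← key]
  exact SetLike.coe_mem _

/-- An algebra endomorphism acting by the sign of the degree on generators acts so everywhere. -/
theorem algHom_eq_sign_smul (𝒜 : ℕ → Submodule K A) [GradedAlgebra 𝒜] {s : Set A}
    (hs : Algebra.adjoin K s = ⊤) (σ : A →ₐ[K] A)
    (hσ : ∀ x ∈ s, ∃ k, x ∈ 𝒜 k ∧ σ x = (-1 : K) ^ k • x) {k : ℕ} {a : A} (ha : a ∈ 𝒜 k) :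
    σ a = (-1 : K) ^ k • a := by
  have hspan := span_eq_top_of_closure_subset (S := {x | ∃ k, x ∈ 𝒜 k ∧ σ x = (-1 : K) ^ k • x})
    hs fun m hm => by
      induction hm using Submonoid.closure_induction with
      | mem x hx => exact hσ x hx
      | one => exact ⟨0, SetLike.GradedOne.one_mem, by simp⟩
      | mul x y _ _ hx hy =>
        obtain ⟨i, hx, hx'⟩ := hx
        obtain ⟨j, hy, hy'⟩ := hy
        refine ⟨i + j, SetLike.GradedMul.mul_mem hx hy, ?_⟩
        rw [map_mul, hx', hy', smul_mul_smul_comm, pow_add]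
  have key : ∀ b : A, σ (GradedAlgebra.proj 𝒜 k b) = (-1 : K) ^ k • GradedAlgebra.proj 𝒜 k b := by
    intro b
    have hb : b ∈ Submodule.span K {x | ∃ k, x ∈ 𝒜 k ∧ σ x = (-1 : K) ^ k • x} :=
      hspan ▸ Submodule.mem_top
    induction hb using Submodule.span_induction with
    | mem x hx =>
      obtain ⟨j, hx, hfx⟩ := hx
      rcases eq_or_ne j k with rfl | hjk
      · simp [GradedAlgebra.proj_apply, DirectSum.decompose_of_mem_same, hx, hfx]
      · simp [GradedAlgebra.proj_apply, DirectSum.decompose_of_mem_ne _ hx hjk]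
    | zero => simp
    | add x y _ _ hx hy => simp only [map_add, hx, hy, smul_add]
    | smul c x _ hx => simp only [map_smul, hx, smul_comm c]
  have := key a
  rwa [GradedAlgebra.proj_apply, DirectSum.decompose_of_mem_same _ ha] at this

/-- In an algebra generated by super-commuting elements every element is the sum of a central
even element and an odd element that super-commutes with everything. -/
theorem exists_even_add_odd {s : Set A} (hs : Algebra.adjoin K s = ⊤) (σ : A →ₐ[K] A)
    (hσσ : ∀ a, σ (σ a) = a)
    (hgen : ∀ x ∈ s, (σ x = x ∧ ∀ a, x * a = a * x) ∨ (σ x = -x ∧ ∀ a, x * a = σ a * x)) (b : A) :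
    ∃ b₀ b₁, b = b₀ + b₁ ∧ (σ b₀ = b₀ ∧ ∀ a, b₀ * a = a * b₀) ∧
      (σ b₁ = -b₁ ∧ ∀ a, b₁ * a = σ a * b₁) := by
  have hb : b ∈ Algebra.adjoin K s := hs ▸ Algebra.mem_top
  induction hb using Algebra.adjoin_induction with
  | mem x hx =>
    rcases hgen x hx with h | h
    · exact ⟨x, 0, by simp, h, by simp⟩
    · exact ⟨0, x, by simp, by simp, h⟩
  | algebraMap r => exact ⟨algebraMap K A r, 0, by simp, ⟨by simp, Algebra.commutes r⟩, by simp⟩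
  | add x y _ _ hx hy =>
    obtain ⟨x₀, x₁, rfl, ⟨h1, h2⟩, h3, h4⟩ := hx
    obtain ⟨y₀, y₁, rfl, ⟨k1, k2⟩, k3, k4⟩ := hy
    refine ⟨x₀ + y₀, x₁ + y₁, by abel, ⟨by simp [h1, k1], fun a => ?_⟩,
      ⟨by rw [map_add, h3, k3]; abel, fun a => ?_⟩⟩
    · rw [add_mul, mul_add, h2, k2]
    · rw [add_mul, mul_add, h4, k4]
  | mul x y _ _ hx hy =>
    obtain ⟨x₀, x₁, rfl, ⟨h1, h2⟩, h3, h4⟩ := hx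
    obtain ⟨y₀, y₁, rfl, ⟨k1, k2⟩, k3, k4⟩ := hy
    refine ⟨x₀ * y₀ + x₁ * y₁, x₀ * y₁ + x₁ * y₀, by noncomm_ring,
      ⟨by simp [h1, k1, h3, k3], fun a => ?_⟩, ⟨by simp [h1, k1, h3, k3, add_comm], fun a => ?_⟩⟩
    · rw [add_mul, mul_add, mul_assoc x₀, k2, ← mul_assoc, h2, mul_assoc a, mul_assoc x₁, k4,
        ← mul_assoc x₁, h4, hσσ, mul_assoc a]
    · rw [add_mul, mul_add, mul_assoc x₀, k4, ← mul_assoc, h2, mul_assoc _ x₀, mul_assoc x₁, k2,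
        ← mul_assoc x₁, h4, mul_assoc _ x₁]

/-- An endomorphism that differs from the identity by a locally nilpotent map is bijective. -/
theorem bijective_of_locally_nilpotent {M : Type*} [AddCommGroup M] [Module K M]
    (G N : M →ₗ[K] M) (hG : ∀ a, G a = a + N a) (hN : ∀ a, ∃ n, (N ^ n) a = 0) :
    Function.Bijective G := by
  constructor
  · rw [injective_iff_map_eq_zero]
    intro a ha
    obtain ⟨n, hn⟩ := hN a
    have hNa : N a = -a := by rw [hG] at ha; exact eq_neg_of_add_eq_zero_right ha
    have key : ∀ n, (N ^ n) a = 0 → a = 0 := by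
      intro n
      induction n with
      | zero => simp
      | succ n ih => intro h; rw [pow_succ, Module.End.mul_apply, hNa, map_neg, neg_eq_zero] at h
                     exact ih h
    exact key n hn
  · intro a
    obtain ⟨n, hn⟩ := hN a
    induction n generalizing a with
    | zero => exact ⟨0, by simpa using hn.symm⟩
    | succ n ih =>
      obtain ⟨b, hb⟩ := ih (N a) (by rwa [pow_succ, Module.End.mul_apply] at hn)
      exact ⟨a - b, by rw [map_sub, hb, hG]; abel⟩

/-- The span of all products of at least `p` elements of `V`. -/
def wordFiltration (V : Submodule K A) (p : ℕ) : Submodule K A :=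
  ⨆ n : ℕ, V ^ (p + n)

theorem pow_le_wordFiltration (V : Submodule K A) {p n : ℕ} (h : p ≤ n) :
    V ^ n ≤ wordFiltration V p := by
  obtain ⟨m, rfl⟩ := Nat.exists_eq_add_of_le h
  exact le_iSup (fun n => V ^ (p + n)) m

theorem wordFiltration_antitone (V : Submodule K A) : Antitone (wordFiltration V) := fun _ _ h =>
  iSup_le fun _ => pow_le_wordFiltration V (h.trans (Nat.le_add_right _ _))

theorem mul_mem_wordFiltration {V : Submodule K A} {p q r : ℕ} (hr : r ≤ p + q) {a b : A}
    (ha : a ∈ wordFiltration V p) (hb : b ∈ wordFiltration V q) :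
    a * b ∈ wordFiltration V r := by
  have h : wordFiltration V p * wordFiltration V q ≤ wordFiltration V r := by
    simp only [wordFiltration, Submodule.iSup_mul, Submodule.mul_iSup]
    refine iSup_le fun i => iSup_le fun j => ?_
    rw [← pow_add]
    exact pow_le_wordFiltration V (by omega)
  exact h (Submodule.mul_mem_mul ha hb)

theorem wordFiltration_zero_eq_top {V : Submodule K A} {s : Set A} (hs : Algebra.adjoin K s = ⊤)
    (hV : V = Submodule.span K s) : wordFiltration V 0 = ⊤ := by
  rw [← Submodule.span_eq (wordFiltration V 0)]
  refine span_eq_top_of_closure_subset hs fun m hm => ?_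
  induction hm using Submonoid.closure_induction with
  | mem x hx =>
    refine pow_le_wordFiltration V (Nat.zero_le 1) ?_
    rw [pow_one, hV]
    exact Submodule.subset_span hx
  | one =>
    refine pow_le_wordFiltration V (le_refl 0) ?_
    rw [pow_zero]
    exact Submodule.one_le.mp (le_refl 1)
  | mul x y _ _ hx hy => exact mul_mem_wordFiltration (Nat.zero_le (0 + 0)) hx hy

theorem idealSpan_le_wordFiltration_one {V : Submodule K A} {s : Set A}
    (hs : Algebra.adjoin K s = ⊤) (hV : V = Submodule.span K s) {a : A}
    (ha : a ∈ Ideal.span (V : Set A)) : a ∈ wordFiltration V 1 := by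
  induction ha using Submodule.span_induction with
  | mem x hx => exact pow_le_wordFiltration V le_rfl (by rwa [pow_one])
  | zero => exact zero_mem _
  | add x y _ _ hx hy => exact add_mem hx hy
  | smul c x _ hx =>
    have hc : c ∈ wordFiltration V 0 := wordFiltration_zero_eq_top hs hV ▸ Submodule.mem_top
    exact mul_mem_wordFiltration le_add_self hc hx

theorem pow_succ_mem_idealSpan {V : Submodule K A} {n : ℕ} {a : A} (ha : a ∈ V ^ (n + 1)) :
    a ∈ Ideal.span (V : Set A) := by
  have h : V ^ (n + 1) ≤ (Ideal.span (V : Set A)).restrictScalars K := by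
    rw [pow_succ, Submodule.mul_le]
    exact fun m _ v hv => Ideal.mul_mem_left _ _ (Ideal.subset_span hv)
  exact h ha

/-- A projection onto `V` killing decomposables is the identity modulo decomposables. -/
theorem sub_proj_mem_wordFiltration_two {V : Submodule K A} {s : Set A}
    (hs : Algebra.adjoin K s = ⊤) (hV : V = Submodule.span K s) (π : A →ₗ[K] A)
    (hπV : ∀ v ∈ V, π v = v)
    (hπmul : ∀ a b : A, a ∈ Ideal.span (V : Set A) → b ∈ Ideal.span (V : Set A) → π (a * b) = 0)
    {a : A} (ha : a ∈ Ideal.span (V : Set A)) : a - π a ∈ wordFiltration V 2 := by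
  have h : wordFiltration V 1 ≤ (wordFiltration V 2).comap (LinearMap.id - π) := by
    refine iSup_le fun n => ?_
    rcases n with _ | n
    · intro v hv
      rw [add_zero, pow_one] at hv
      simp [hπV v hv]
    · intro x hx
      have hx' : π x = 0 := by
        have hle : V ^ (1 + (n + 1)) ≤ LinearMap.ker π := by
          rw [pow_add, pow_one, Submodule.mul_le]
          exact fun v hv m hm => hπmul v m (Ideal.subset_span hv) (pow_succ_mem_idealSpan hm)
        exact hle hx
      have := pow_le_wordFiltration V (show 2 ≤ 1 + (n + 1) by omega) hx
      simpa [hx'] using this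
  exact h (idealSpan_le_wordFiltration_one hs hV ha)

theorem sub_id_mem_wordFiltration {V : Submodule K A} (G : A →ₐ[K] A)
    (hG : ∀ v ∈ V, G v - v ∈ wordFiltration V 2) {p : ℕ} {a : A} (ha : a ∈ wordFiltration V p) :
    G a - a ∈ wordFiltration V (p + 1) := by
  have hpow : ∀ n, V ^ n ≤ (wordFiltration V (n + 1)).comap (G.toLinearMap - LinearMap.id) := by
    intro n
    induction n with
    | zero =>
      rw [pow_zero, Submodule.one_le]
      simp
    | succ n ih =>
      rw [pow_succ, Submodule.mul_le]
      intro m hm v hv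
      have h1 : G m - m ∈ wordFiltration V (n + 1) := ih hm
      have h2 := hG v hv
      have h3 : v ∈ wordFiltration V 1 := pow_le_wordFiltration V le_rfl (by rwa [pow_one])
      have h4 : G v ∈ wordFiltration V 1 := by
        simpa using add_mem (wordFiltration_antitone V one_le_two h2) h3
      have h5 : G (m * v) - m * v = (G m - m) * G v + m * (G v - v) := by
        rw [map_mul]; noncomm_ring
      simp only [Submodule.mem_comap, LinearMap.sub_apply, AlgHom.toLinearMap_apply,
        LinearMap.id_apply, h5]
      exact add_mem (mul_mem_wordFiltration le_rfl h1 h4)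
        (mul_mem_wordFiltration (le_refl (n + 2)) (pow_le_wordFiltration V (le_refl n) hm) h2)
  have h : wordFiltration V p ≤
      (wordFiltration V (p + 1)).comap (G.toLinearMap - LinearMap.id) :=
    iSup_le fun n => (hpow _).trans
      (Submodule.comap_mono (wordFiltration_antitone V (by omega)))
  exact h ha

theorem eq_zero_of_mem_wordFiltration (𝒜 : ℕ → Submodule K A) [GradedAlgebra 𝒜]
    {V : Submodule K A} {s : Set A} (hV : V = Submodule.span K s)
    (hdeg : ∀ x ∈ s, ∃ k, 1 ≤ k ∧ x ∈ 𝒜 k) {p k : ℕ} (hkp : k < p) {a : A}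
    (ha : a ∈ wordFiltration V p) (hak : a ∈ 𝒜 k) : a = 0 := by
  have hpow : ∀ n, V ^ n ≤ Submodule.span K {x | ∃ k, n ≤ k ∧ x ∈ 𝒜 k} := by
    intro n
    induction n with
    | zero =>
      rw [pow_zero, Submodule.one_le]
      exact Submodule.subset_span ⟨0, le_rfl, SetLike.GradedOne.one_mem⟩
    | succ n ih =>
      rw [pow_succ]
      refine (mul_le_mul' ih hV.le).trans ?_
      rw [Submodule.span_mul_span, Submodule.span_le]
      rintro _ ⟨x, ⟨i, hi, hx⟩, y, hy, rfl⟩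
      obtain ⟨j, hj, hy⟩ := hdeg y hy
      exact Submodule.subset_span ⟨i + j, by omega, SetLike.GradedMul.mul_mem hx hy⟩
  have hle : wordFiltration V p ≤ LinearMap.ker (GradedAlgebra.proj 𝒜 k) := by
    refine iSup_le fun n => (hpow _).trans ?_
    rw [Submodule.span_le]
    rintro x ⟨j, hj, hx⟩
    simp [GradedAlgebra.proj_apply, DirectSum.decompose_of_mem_ne _ hx (show j ≠ k by omega)]
  have := hle ha
  rwa [LinearMap.mem_ker, GradedAlgebra.proj_apply, DirectSum.decompose_of_mem_same _ hak] at this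

/-- A degree-preserving algebra endomorphism of a graded algebra generated in positive degrees that
is the identity modulo decomposables is bijective. -/
theorem bijective_of_sub_id_decomposable (𝒜 : ℕ → Submodule K A) [GradedAlgebra 𝒜]
    {V : Submodule K A} {s : Set A} (hs : Algebra.adjoin K s = ⊤) (hV : V = Submodule.span K s)
    (hdeg : ∀ x ∈ s, ∃ k, 1 ≤ k ∧ x ∈ 𝒜 k) (G : A →ₐ[K] A)
    (hG : ∀ v ∈ V, G v - v ∈ wordFiltration V 2) (hGdeg : ∀ x ∈ s, ∃ k, x ∈ 𝒜 k ∧ G x ∈ 𝒜 k) :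
    Function.Bijective G := by
  have hspan := span_eq_top_of_closure_subset (S := {x | ∃ k, x ∈ 𝒜 k ∧ G x ∈ 𝒜 k})
    hs fun m hm => by
      induction hm using Submonoid.closure_induction with
      | mem x hx => exact hGdeg x hx
      | one => exact ⟨0, SetLike.GradedOne.one_mem, by rw [map_one]; exact SetLike.GradedOne.one_mem⟩
      | mul x y _ _ hx hy =>
        obtain ⟨i, hx, hx'⟩ := hx
        obtain ⟨j, hy, hy'⟩ := hy
        exact ⟨i + j, SetLike.GradedMul.mul_mem hx hy,
          by rw [map_mul]; exact SetLike.GradedMul.mul_mem hx' hy'⟩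
  have hGk : ∀ k, ∀ a ∈ 𝒜 k, G a ∈ 𝒜 k := fun k a ha =>
    mem_graded_of_mem_span 𝒜 G.toLinearMap (v := a)
      (by simp only [AlgHom.toLinearMap_apply, hspan, Submodule.mem_top]) ha
  set N : A →ₗ[K] A := G.toLinearMap - LinearMap.id with hN
  have hNG : ∀ a, N a = G a - a := fun a => by simp [hN]
  refine bijective_of_locally_nilpotent G.toLinearMap N (fun a => by simp [hN]) fun a => ?_
  have hstep : ∀ k, ∀ a ∈ 𝒜 k, ∀ n, (N ^ n) a ∈ 𝒜 k ∧ (N ^ n) a ∈ wordFiltration V n := by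
    intro k a ha n
    induction n with
    | zero => exact ⟨by simpa using ha, wordFiltration_zero_eq_top hs hV ▸ Submodule.mem_top⟩
    | succ n ih =>
      rw [pow_succ', Module.End.mul_apply, hNG]
      exact ⟨sub_mem (hGk k _ ih.1) ih.1, sub_id_mem_wordFiltration G hG ih.2⟩
  have hmono : ∀ {m n : ℕ} {b : A}, m ≤ n → (N ^ m) b = 0 → (N ^ n) b = 0 := by
    intro m n b hmn hb
    rw [← Nat.sub_add_cancel hmn, pow_add, Module.End.mul_apply, hb, map_zero]
  induction a using DirectSum.Decomposition.inductionOn 𝒜 with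
  | zero => exact ⟨0, by simp⟩
  | @homogeneous i m =>
    have := hstep i m m.2 (i + 1)
    exact ⟨i + 1, eq_zero_of_mem_wordFiltration 𝒜 hV hdeg (Nat.lt_succ_self i) this.2 this.1⟩
  | add x y hx hy =>
    obtain ⟨m, hm⟩ := hx
    obtain ⟨n, hn⟩ := hy
    exact ⟨max m n, by
      rw [map_add, hmono (le_max_left m n) hm, hmono (le_max_right m n) hn, add_zero]⟩

/-- A projection onto the generators killing `1` and decomposables preserves degrees. -/
theorem proj_mem_graded (𝒜 : ℕ → Submodule K A) [GradedAlgebra 𝒜]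
    {V : Submodule K A} {s : Set A} (hs : Algebra.adjoin K s = ⊤) (hV : V = Submodule.span K s)
    (hdeg : ∀ x ∈ s, ∃ k, x ∈ 𝒜 k) (π : A →ₗ[K] A) (hπ1 : π 1 = 0) (hπV : ∀ v ∈ V, π v = v)
    (hπmul : ∀ a b : A, a ∈ Ideal.span (V : Set A) → b ∈ Ideal.span (V : Set A) → π (a * b) = 0)
    {k : ℕ} {a : A} (ha : a ∈ 𝒜 k) : π a ∈ 𝒜 k := by
  have hsV : s ⊆ V := hV ▸ Submodule.subset_span
  have hspan := span_eq_top_of_closure_subset (S := {x | ∃ k, x ∈ 𝒜 k ∧ π x ∈ 𝒜 k})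
    hs fun m hm => by
      have : (∃ k, m ∈ 𝒜 k) ∧
          (m = 1 ∨ m ∈ Ideal.span (V : Set A) ∧ (π m = m ∨ π m = 0)) := by
        induction hm using Submonoid.closure_induction with
        | mem x hx =>
          exact ⟨hdeg x hx, Or.inr ⟨Ideal.subset_span (hsV hx), Or.inl (hπV x (hsV hx))⟩⟩
        | one => exact ⟨⟨0, SetLike.GradedOne.one_mem⟩, Or.inl rfl⟩
        | mul x y _ _ hx hy =>
          obtain ⟨⟨i, hxi⟩, hx⟩ := hx
          obtain ⟨⟨j, hyj⟩, hy⟩ := hy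
          refine ⟨⟨i + j, SetLike.GradedMul.mul_mem hxi hyj⟩, ?_⟩
          rcases hx with rfl | hx
          · simpa using hy
          rcases hy with rfl | hy
          · simpa using Or.inr hx
          exact Or.inr ⟨Ideal.mul_mem_left _ _ hy.1, Or.inr (hπmul x y hx.1 hy.1)⟩
      obtain ⟨⟨k, hk⟩, rfl | ⟨_, h | h⟩⟩ := this
      · exact ⟨k, hk, by rw [hπ1]; exact zero_mem _⟩
      · exact ⟨k, hk, by rwa [h]⟩
      · exact ⟨k, hk, by rw [h]; exact zero_mem _⟩
  exact mem_graded_of_mem_span 𝒜 π (by rw [hspan]; exact Submodule.mem_top) ha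

/-- A linear map prescribed on the three summands of `U ⊕ δU ⊕ W`. -/
theorem exists_linearMap_of_splitting {M : Type*} [AddCommGroup M] [Module K M]
    (U W : Submodule K M) (δ d : M →ₗ[K] M) (hdisj1 : Disjoint U (U.map δ ⊔ W))
    (hdisj2 : Disjoint (U.map δ) W) (hinj : ∀ u ∈ U, δ u = 0 → u = 0) :
    ∃ φ : M →ₗ[K] M, (∀ w ∈ W, φ w = w) ∧ (∀ u ∈ U, φ u = u) ∧ ∀ u ∈ U, φ (δ u) = d u := by
  let L : (U × U × W) →ₗ[K] M :=
    U.subtype.coprod ((δ ∘ₗ U.subtype).coprod W.subtype)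
  have hL : LinearMap.ker L = ⊥ := by
    rw [LinearMap.ker_eq_bot']
    rintro ⟨u, u', w⟩ h
    replace h : (u : M) + (δ u' + w) = 0 := h
    have hmem : δ u' + (w : M) ∈ U.map δ ⊔ W :=
      Submodule.add_mem_sup (Submodule.mem_map_of_mem u'.2) w.2
    have hu : (u : M) = 0 := by
      refine Submodule.disjoint_def.mp hdisj1 _ u.2 ?_
      rw [eq_neg_of_add_eq_zero_left h]
      exact neg_mem hmem
    rw [hu, zero_add] at h
    have hw : δ (u' : M) = 0 := by
      refine Submodule.disjoint_def.mp hdisj2 _ (Submodule.mem_map_of_mem u'.2) ?_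
      rw [eq_neg_of_add_eq_zero_left h]
      exact neg_mem w.2
    rw [hw, zero_add] at h
    have hu' := hinj _ u'.2 hw
    ext <;> simp [hu, hu', h]
  obtain ⟨g, hg⟩ := L.exists_leftInverse_of_injective hL
  have hgL : ∀ x, g (L x) = x := fun x => LinearMap.congr_fun hg x
  refine ⟨(U.subtype.coprod ((d ∘ₗ U.subtype).coprod W.subtype)) ∘ₗ g, fun w hw => ?_,
    fun u hu => ?_, fun u hu => ?_⟩
  · have := hgL (0, 0, ⟨w, hw⟩)
    simp only [L, LinearMap.coprod_apply, map_zero, zero_add, Submodule.subtype_apply] at this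
    simp [this]
  · have := hgL (⟨u, hu⟩, 0, 0)
    simp only [L, LinearMap.coprod_apply, map_zero, add_zero, Submodule.subtype_apply] at this
    simp [this]
  · have := hgL (0, ⟨u, hu⟩, 0)
    simp only [L, LinearMap.coprod_apply, map_zero, add_zero, zero_add, Submodule.subtype_apply,
      LinearMap.comp_apply] at this
    simp [this]

end GradedGenerators

section FreeGC

variable (K : Type) [Field K] (ι κ : Type)

theorem adjoin_genEv_genOd :
    Algebra.adjoin K (Set.range (genEv K ι κ) ∪ Set.range (genOd K ι κ)) = ⊤ := by
  set S := Algebra.adjoin K (Set.range (genEv K ι κ) ∪ Set.range (genOd K ι κ))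
  have hE : ∀ p : MvPolynomial ι K, p ⊗ₜ[K] (1 : ExteriorAlgebra K (κ →₀ K)) ∈ S := by
    have h : (⊤ : Subalgebra K (MvPolynomial ι K)) ≤
        S.comap (Algebra.TensorProduct.includeLeft : MvPolynomial ι K →ₐ[K] FreeGC K ι κ) := by
      rw [← MvPolynomial.adjoin_range_X, Algebra.adjoin_le_iff]
      rintro _ ⟨i, rfl⟩
      exact Algebra.subset_adjoin (Or.inl ⟨i, rfl⟩)
    exact fun p => h Algebra.mem_top
  have hO : ∀ w : ExteriorAlgebra K (κ →₀ K), (1 : MvPolynomial ι K) ⊗ₜ[K] w ∈ S := by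
    have hι : (⊤ : Submodule K (κ →₀ K)) ≤ (Subalgebra.toSubmodule S).comap
        ((Algebra.TensorProduct.includeRight :
          ExteriorAlgebra K (κ →₀ K) →ₐ[K] FreeGC K ι κ).toLinearMap ∘ₗ ExteriorAlgebra.ι K) := by
      rw [← (Finsupp.basisSingleOne (R := K) (ι := κ)).span_eq, Submodule.span_le]
      rintro _ ⟨j, rfl⟩
      rw [Finsupp.coe_basisSingleOne]
      exact Algebra.subset_adjoin (Or.inr ⟨j, rfl⟩)
    have h : (⊤ : Subalgebra K (ExteriorAlgebra K (κ →₀ K))) ≤ S.comap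
        (Algebra.TensorProduct.includeRight :
          ExteriorAlgebra K (κ →₀ K) →ₐ[K] FreeGC K ι κ) := by
      rw [← CliffordAlgebra.adjoin_range_ι, Algebra.adjoin_le_iff]
      rintro _ ⟨v, rfl⟩
      exact hι (Submodule.mem_top (x := v))
    exact fun w => h Algebra.mem_top
  rw [eq_top_iff]
  rintro x -
  induction x using TensorProduct.induction_on with
  | zero => exact zero_mem S
  | tmul p w => simpa using mul_mem (hE p) (hO w)
  | add x y hx hy => exact add_mem hx hy

theorem genEv_mul_comm (i : ι) (a : FreeGC K ι κ) : genEv K ι κ i * a = a * genEv K ι κ i := by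
  induction a using TensorProduct.induction_on with
  | zero => simp
  | tmul p w => simp [genEv, Algebra.TensorProduct.tmul_mul_tmul, mul_comm]
  | add x y hx hy => rw [mul_add, add_mul, hx, hy]

theorem genOd_mul_genOd (i j : κ) :
    genOd K ι κ i * genOd K ι κ j = -(genOd K ι κ j * genOd K ι κ i) := by
  simp only [genOd, Algebra.TensorProduct.tmul_mul_tmul, mul_one]
  rw [eq_neg_of_add_eq_zero_left (ExteriorAlgebra.ι_add_mul_swap _ _), TensorProduct.tmul_neg]

variable {K ι κ}

theorem genOd_mul_eq_parity_mul (σ : FreeGC K ι κ →ₐ[K] FreeGC K ι κ)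
    (hσx : ∀ i, σ (genEv K ι κ i) = genEv K ι κ i)
    (hσy : ∀ j, σ (genOd K ι κ j) = - genOd K ι κ j) (j : κ) (a : FreeGC K ι κ) :
    genOd K ι κ j * a = σ a * genOd K ι κ j := by
  have ha : a ∈ Algebra.adjoin K (Set.range (genEv K ι κ) ∪ Set.range (genOd K ι κ)) :=
    adjoin_genEv_genOd K ι κ ▸ Algebra.mem_top
  induction ha using Algebra.adjoin_induction with
  | mem x hx =>
    rcases hx with ⟨i, rfl⟩ | ⟨i, rfl⟩
    · rw [hσx, genEv_mul_comm]
    · rw [hσy, genOd_mul_genOd]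
      exact (neg_mul (genOd K ι κ i) (genOd K ι κ j)).symm
  | algebraMap r => rw [AlgHom.commutes, Algebra.commutes]
  | add x y _ _ hx hy => rw [mul_add, hx, hy, map_add, add_mul]
  | mul x y _ _ hx hy => rw [← mul_assoc, hx, mul_assoc, hy, map_mul, mul_assoc]

theorem parity_parity (σ : FreeGC K ι κ →ₐ[K] FreeGC K ι κ)
    (hσx : ∀ i, σ (genEv K ι κ i) = genEv K ι κ i)
    (hσy : ∀ j, σ (genOd K ι κ j) = - genOd K ι κ j) (a : FreeGC K ι κ) : σ (σ a) = a := by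
  have h : σ.comp σ = AlgHom.id K _ := by
    refine AlgHom.ext_of_adjoin_eq_top (adjoin_genEv_genOd K ι κ) ?_
    rintro _ (⟨i, rfl⟩ | ⟨i, rfl⟩)
    · simp [hσx]
    · simp [hσy]
  exact DFunLike.congr_fun h a

/-- Parity-even elements are central and parity-odd elements square to zero. -/
theorem parity_supercommutative [CharZero K] (σ : FreeGC K ι κ →ₐ[K] FreeGC K ι κ)
    (hσx : ∀ i, σ (genEv K ι κ i) = genEv K ι κ i)
    (hσy : ∀ j, σ (genOd K ι κ j) = - genOd K ι κ j) (b : FreeGC K ι κ) :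
    (σ b = b → ∀ a, b * a = a * b) ∧ (σ b = -b → b * b = 0) := by
  obtain ⟨b₀, b₁, rfl, ⟨h1, h2⟩, h3, h4⟩ := exists_even_add_odd (adjoin_genEv_genOd K ι κ) σ
    (parity_parity σ hσx hσy) (by
      rintro _ (⟨i, rfl⟩ | ⟨i, rfl⟩)
      · exact Or.inl ⟨hσx i, genEv_mul_comm K ι κ i⟩
      · exact Or.inr ⟨hσy i, genOd_mul_eq_parity_mul σ hσx hσy i⟩) b
  have htwo : ∀ x : FreeGC K ι κ, x = -x → x = 0 := by
    intro x hx
    have h : (2 : K) • x = 0 := by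
      rw [two_smul]
      nth_rewrite 2 [hx]
      exact add_neg_cancel x
    exact (smul_eq_zero_iff_right two_ne_zero).mp h
  rw [map_add, h1, h3]
  constructor
  · intro h
    have hb : b₁ = 0 := htwo _ (add_left_cancel h).symm
    simpa [hb] using h2
  · intro h
    have hb : b₀ = 0 := by
      rw [neg_add] at h
      exact htwo _ (add_right_cancel h)
    have := h4 b₁
    rw [h3] at this
    simpa [hb] using htwo _ (this.trans (neg_mul b₁ b₁))

/-- The universal property of `FreeGC`: even generators may be sent to central elements and odd
generators to elements whose linear combinations square to zero. -/
theorem exists_algHom_of_generators {A : Type*} [Ring A] [Algebra K A] (φ : FreeGC K ι κ →ₗ[K] A)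
    (hE : ∀ i a, φ (genEv K ι κ i) * a = a * φ (genEv K ι κ i))
    (hO : ∀ v ∈ Submodule.span K (Set.range (genOd K ι κ)), φ v * φ v = 0) :
    ∃ G : FreeGC K ι κ →ₐ[K] A, (∀ i, G (genEv K ι κ i) = φ (genEv K ι κ i)) ∧
      ∀ j, G (genOd K ι κ j) = φ (genOd K ι κ j) := by
  let f : MvPolynomial ι K →ₐ[K] A := (Subalgebra.center K A).val.comp
    (MvPolynomial.aeval fun i => (⟨φ (genEv K ι κ i),
      Subalgebra.mem_center_iff.mpr fun a => (hE i a).symm⟩ : Subalgebra.center K A))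
  let l : (κ →₀ K) →ₗ[K] A := φ ∘ₗ Finsupp.linearCombination K (genOd K ι κ)
  have hl : ∀ m, l m * l m = 0 := fun m =>
    hO _ (Finsupp.mem_span_range_iff_exists_finsupp.mpr ⟨m, rfl⟩)
  have hcomm : ∀ p w, Commute (f p) (ExteriorAlgebra.lift K ⟨l, hl⟩ w) := fun p w =>
    (Subalgebra.mem_center_iff.mp (Subtype.coe_prop _) _).symm
  refine ⟨Algebra.TensorProduct.lift f (ExteriorAlgebra.lift K ⟨l, hl⟩) hcomm,
    fun i => ?_, fun j => ?_⟩
  · simp [genEv, f]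
  · have hl₁ : l (Finsupp.single j 1) = φ (genOd K ι κ j) := by simp [l]
    rw [← hl₁, genOd, Algebra.TensorProduct.lift_tmul, map_one, one_mul,
      ExteriorAlgebra.lift_ι_apply]

end FreeGC

set_option maxHeartbeats 1000000 in
set_option synthInstance.maxHeartbeats 400000 in
/-- Let `(ΛV, d)` be a Sullivan algebra with linear part
`d₀ = π ∘ d` of the differential (`π` the projection of `ΛV` onto `V` killing
`1` and all decomposable elements).  If `V = U ⊕ d₀U ⊕ W` with
`d₀|_U : U ≅ d₀U`, then the inclusion `W ⊕ U ⊕ dU → ΛV` induces an isomorphism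
of graded algebras `Λ(W ⊕ U ⊕ dU) ≅ ΛV`; i.e. the (unique) algebra endomorphism
`G` of `ΛV` which is the identity on `W` and `U` and sends `d₀ u ↦ d u` is
bijective. -/
theorem stmt_12 (K : Type) [Field K] [CharZero K] (ι κ : Type) [Finite ι] [Finite κ]
    -- the degree grading
    (𝒜 : ℕ → Submodule K (FreeGC K ι κ)) [GradedAlgebra 𝒜]
    (degE : ι → ℕ) (degO : κ → ℕ)
    (hdegE : ∀ i, genEv K ι κ i ∈ 𝒜 (degE i) ∧ Even (degE i) ∧ 2 ≤ degE i)
    (hdegO : ∀ j, genOd K ι κ j ∈ 𝒜 (degO j) ∧ Odd (degO j) ∧ 2 ≤ degO j)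
    (h𝒜0 : 𝒜 0 ≤ Submodule.span K {1})
    -- the space of generators and the augmentation ideal
    (V : Submodule K (FreeGC K ι κ))
    (hV : V = Submodule.span K
      (Set.range (genEv K ι κ) ∪ Set.range (genOd K ι κ)))
    -- the differential, a degree `+1` derivation (Koszul signs via `σ`)
    (σ : FreeGC K ι κ →ₐ[K] FreeGC K ι κ)
    (hσx : ∀ i, σ (genEv K ι κ i) = genEv K ι κ i)
    (hσy : ∀ j, σ (genOd K ι κ j) = - genOd K ι κ j)
    (d : FreeGC K ι κ →ₗ[K] FreeGC K ι κ)
    (hdleib : ∀ a b, d (a * b) = d a * b + σ a * d b)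
    (hd2 : ∀ a, d (d a) = 0)
    (hddeg : ∀ k, ∀ a ∈ 𝒜 k, d a ∈ 𝒜 (k + 1))
    (hdV : ∀ v ∈ V, d v ∈ Ideal.span (V : Set (FreeGC K ι κ)))
    -- the projection onto the space of generators, and the linear part of `d`
    (π : FreeGC K ι κ →ₗ[K] FreeGC K ι κ)
    (hπ1 : π 1 = 0)
    (hπV : ∀ v ∈ V, π v = v)
    (hπrange : ∀ a, π a ∈ V)
    (hπmul : ∀ a b : FreeGC K ι κ, a ∈ Ideal.span (V : Set (FreeGC K ι κ)) →
      b ∈ Ideal.span (V : Set (FreeGC K ι κ)) → π (a * b) = 0)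
    -- the splitting `V = U ⊕ d₀U ⊕ W`, where `d₀ = π ∘ d`
    (U W : Submodule K (FreeGC K ι κ)) (hUV : U ≤ V) (hWV : W ≤ V)
    (hUgr : (⨆ k : ℕ, U ⊓ 𝒜 k) = U) (hWgr : (⨆ k : ℕ, W ⊓ 𝒜 k) = W)
    (hsup : U ⊔ U.map (π ∘ₗ d) ⊔ W = V)
    (hdisj1 : Disjoint U (U.map (π ∘ₗ d) ⊔ W))
    (hdisj2 : Disjoint (U.map (π ∘ₗ d)) W)
    (hinj : ∀ u ∈ U, π (d u) = 0 → u = 0) :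
    ∃ G : FreeGC K ι κ →ₐ[K] FreeGC K ι κ,
      (∀ w ∈ W, G w = w) ∧
      (∀ u ∈ U, G u = u) ∧
      (∀ u ∈ U, G (π (d u)) = d u) ∧
      Function.Bijective G := by
  set s := Set.range (genEv K ι κ) ∪ Set.range (genOd K ι κ)
  have hs : Algebra.adjoin K s = ⊤ := adjoin_genEv_genOd K ι κ
  have hsV : s ⊆ V := hV ▸ Submodule.subset_span
  have hdeg : ∀ x ∈ s, ∃ k, 1 ≤ k ∧ x ∈ 𝒜 k := by
    rintro _ (⟨i, rfl⟩ | ⟨j, rfl⟩)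
    · exact ⟨degE i, one_le_two.trans (hdegE i).2.2, (hdegE i).1⟩
    · exact ⟨degO j, one_le_two.trans (hdegO j).2.2, (hdegO j).1⟩
  have hπdeg : ∀ {k : ℕ} {a : FreeGC K ι κ}, a ∈ 𝒜 k → π a ∈ 𝒜 k := fun ha =>
    proj_mem_graded 𝒜 hs hV (fun x hx => (hdeg x hx).imp fun _ h => h.2) π hπ1 hπV hπmul ha
  have hσdeg : ∀ {k : ℕ} {a : FreeGC K ι κ}, a ∈ 𝒜 k → σ a = (-1 : K) ^ k • a := fun ha =>
    algHom_eq_sign_smul 𝒜 hs σ (by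
      rintro _ (⟨i, rfl⟩ | ⟨j, rfl⟩)
      · exact ⟨degE i, (hdegE i).1, by rw [hσx, (hdegE i).2.1.neg_one_pow, one_smul]⟩
      · exact ⟨degO j, (hdegO j).1, by
          rw [hσy, (hdegO j).2.1.neg_one_pow]
          exact (neg_one_smul K _).symm⟩) ha
  obtain ⟨φ, hφW, hφU, hφd⟩ := exists_linearMap_of_splitting U W (π ∘ₗ d) d hdisj1 hdisj2 hinj
  have hφspan : V ≤ Submodule.span K {x | ∃ k, x ∈ 𝒜 k ∧ φ x ∈ 𝒜 k} := by
    rw [← hsup]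
    refine sup_le (sup_le ?_ ?_) ?_
    · rw [← hUgr]
      exact iSup_le fun k x hx => Submodule.subset_span ⟨k, hx.2, by rw [hφU x hx.1]; exact hx.2⟩
    · rw [← hUgr, Submodule.map_iSup]
      refine iSup_le fun k => ?_
      rintro _ ⟨u, hu, rfl⟩
      have hdu := hddeg k u hu.2
      exact Submodule.subset_span ⟨k + 1, hπdeg hdu, by rw [hφd u hu.1]; exact hdu⟩
    · rw [← hWgr]
      exact iSup_le fun k x hx => Submodule.subset_span ⟨k, hx.2, by rw [hφW x hx.1]; exact hx.2⟩
  have hφdeg : ∀ {k : ℕ} {v : FreeGC K ι κ}, v ∈ V → v ∈ 𝒜 k → φ v ∈ 𝒜 k := fun hv hk =>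
    mem_graded_of_mem_span 𝒜 φ (hφspan hv) hk
  have hφE : ∀ i a, φ (genEv K ι κ i) * a = a * φ (genEv K ι κ i) := fun i => by
    refine (parity_supercommutative σ hσx hσy _).1 ?_
    rw [hσdeg (hφdeg (hsV (Or.inl ⟨i, rfl⟩)) (hdegE i).1), (hdegE i).2.1.neg_one_pow, one_smul]
  have hφO : ∀ v ∈ Submodule.span K (Set.range (genOd K ι κ)), φ v * φ v = 0 := by
    intro v hv
    refine (parity_supercommutative σ hσx hσy _).2 ?_
    induction hv using Submodule.span_induction with
    | mem x hx =>
      obtain ⟨j, rfl⟩ := hx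
      rw [hσdeg (hφdeg (hsV (Or.inr ⟨j, rfl⟩)) (hdegO j).1), (hdegO j).2.1.neg_one_pow]
      exact neg_one_smul K (φ (genOd K ι κ j))
    | zero => simp
    | add x y _ _ hx hy => rw [map_add, map_add, hx, hy, neg_add]
    | smul c x _ hx => rw [map_smul, map_smul, hx, smul_neg]
  obtain ⟨G, hGE, hGO⟩ := exists_algHom_of_generators φ hφE hφO
  have hGs : ∀ x ∈ s, G x = φ x := by
    rintro _ (⟨i, rfl⟩ | ⟨j, rfl⟩)
    · exact hGE i
    · exact hGO j
  have hGφ : ∀ v ∈ V, G v = φ v := by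
    intro v hv
    rw [hV] at hv
    exact LinearMap.eqOn_span (f := G.toLinearMap) (g := φ) hGs hv
  refine ⟨G, fun w hw => by rw [hGφ w (hWV hw), hφW w hw],
    fun u hu => by rw [hGφ u (hUV hu), hφU u hu],
    fun u hu => (hGφ _ (hπrange _)).trans (hφd u hu), ?_⟩
  refine bijective_of_sub_id_decomposable 𝒜 hs hV hdeg G ?_ fun x hx => ?_
  · have hle : V ≤ (wordFiltration V 2).comap (φ - LinearMap.id) := by
      conv_lhs => rw [← hsup]
      refine sup_le (sup_le (fun u hu => ?_) ?_) fun w hw => ?_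
      · simp [hφU u hu]
      · rintro _ ⟨u, hu, rfl⟩
        rw [Submodule.mem_comap, LinearMap.sub_apply, LinearMap.id_apply, hφd u hu]
        exact sub_proj_mem_wordFiltration_two hs hV π hπV hπmul (hdV u (hUV hu))
      · simp [hφW w hw]
    intro v hv
    rw [hGφ v hv]
    exact hle hv
  · obtain ⟨k, -, hk⟩ := hdeg x hx
    exact ⟨k, hk, by rw [hGs x hx]; exact hφdeg (hsV hx) hk⟩
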